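/- Let n ≥ 2 be a natural number, t₁ > 1 a real number, and let m : ℝ → ℝ be continuous. Suppose that for every t ≥ t₁ one has −m(t) ≥ (1/(n−1))·∫₁ᵗ m(s)² ds + 2n. Then for every natural number ℓ ≥ 1 and every t ≥ t₁ + 2 − 2^{2−ℓ}, one has −m(t) ≥ 2^ℓ·n. -/

import Mathlib

open MeasureTheory

/-- The inductive claim in Section 5 of the paper: if `−m(t) ≥ (1/(n−1))·∫₁ᵗ m² + 2n`
for all `t ≥ t₁`, then `−m(t) ≥ 2^ℓ·n` for all `t ≥ t_ℓ = t₁ + 2 − 2^{2−ℓ}`. -/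
theorem stmt_15 (n : ℕ) (hn : 2 ≤ n) (t₁ : ℝ) (ht₁ : 1 < t₁) (m : ℝ → ℝ)
    (hm : Continuous m)
    (hyp : ∀ t, t₁ ≤ t →
      (1 / ((n : ℝ) - 1)) * (∫ s in (1 : ℝ)..t, (m s) ^ 2) + 2 * (n : ℝ) ≤ -m t) :
    ∀ ℓ : ℕ, 1 ≤ ℓ → ∀ t : ℝ, t₁ + 2 - (2 : ℝ) ^ ((2 : ℤ) - (ℓ : ℤ)) ≤ t →
      (2 : ℝ) ^ ℓ * (n : ℝ) ≤ -m t := by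
  have hn' : (2 : ℝ) ≤ (n : ℝ) := by exact_mod_cast hn
  have hint : ∀ a b : ℝ, IntervalIntegrable (fun s => (m s) ^ 2) volume a b :=
    fun a b => (hm.pow 2).intervalIntegrable a b
  intro ℓ hℓ
  induction ℓ, hℓ using Nat.le_induction with
  | base =>
    intro t ht
    have ht' : t₁ ≤ t := by norm_num at ht; exact ht
    have h0 : 0 ≤ ∫ s in (1 : ℝ)..t, (m s) ^ 2 :=
      intervalIntegral.integral_nonneg (by linarith) (fun s _ => sq_nonneg _)
    have h1 : 0 ≤ 1 / ((n : ℝ) - 1) := by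
      apply div_nonneg <;> linarith
    have := hyp t ht'
    have h2 := mul_nonneg h1 h0
    rw [pow_one]
    linarith
  | succ k hk ih =>
    intro t ht
    obtain ⟨d, hd⟩ : ∃ d : ℝ, d = (2 : ℝ) ^ ((1 : ℤ) - (k : ℤ)) := ⟨_, rfl⟩
    have e1 : (2 : ℝ) ^ ((2 : ℤ) - (k : ℤ)) = 2 * d := by
      rw [hd, show (2 : ℤ) - (k : ℤ) = 1 + (1 - k) by ring, zpow_add₀ (by norm_num : (2:ℝ) ≠ 0),
        zpow_one]
    have e2 : (2 : ℝ) ^ ((2 : ℤ) - ((k + 1 : ℕ) : ℤ)) = d := by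
      rw [hd]; congr 1; push_cast; ring
    have e3 : d * (2 : ℝ) ^ k = 2 := by
      rw [hd, ← zpow_natCast, ← zpow_add₀ (by norm_num : (2:ℝ) ≠ 0)]
      norm_num
    have hd0 : 0 < d := by rw [hd]; positivity
    have hp : (2 : ℝ) ≤ 2 ^ k := by
      calc (2 : ℝ) = 2 ^ 1 := by norm_num
        _ ≤ 2 ^ k := pow_le_pow_right₀ (by norm_num) hk
    have hd1 : d ≤ 1 := by nlinarith
    rw [e1] at ih
    rw [e2] at ht
    obtain ⟨a, ha⟩ : ∃ a : ℝ, a = t₁ + 2 - 2 * d := ⟨_, rfl⟩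
    rw [← ha] at ih
    have hat : d ≤ t - a := by linarith
    have h1a : 1 ≤ a := by linarith
    have hsplit := intervalIntegral.integral_add_adjacent_intervals (hint 1 a) (hint a t)
    have hA : 0 ≤ ∫ s in (1 : ℝ)..a, (m s) ^ 2 :=
      intervalIntegral.integral_nonneg h1a (fun s _ => sq_nonneg _)
    have hB : (t - a) * ((2 : ℝ) ^ k * n) ^ 2 ≤ ∫ s in a..t, (m s) ^ 2 := by
      have := intervalIntegral.integral_mono_on (μ := volume) (a := a) (b := t)
        (f := fun _ => ((2 : ℝ) ^ k * n) ^ 2) (g := fun s => (m s) ^ 2) (by linarith)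
        intervalIntegrable_const (hint a t) (fun s hs => by
          have h := ih s hs.1
          have h' : (0 : ℝ) ≤ 2 ^ k * n := by positivity
          have h'' := pow_le_pow_left₀ h' h 2
          simpa using h'')
      simpa using this
    have hC : d * ((2 : ℝ) ^ k * n) ^ 2 ≤ (t - a) * ((2 : ℝ) ^ k * n) ^ 2 :=
      mul_le_mul_of_nonneg_right hat (sq_nonneg _)
    have hD : d * ((2 : ℝ) ^ k * n) ^ 2 = 2 ^ (k + 1) * n * n := by
      calc d * ((2 : ℝ) ^ k * n) ^ 2 = (d * 2 ^ k) * 2 ^ k * n * n := by ring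
        _ = _ := by rw [e3]; ring
    have hE : (2 : ℝ) ^ (k + 1) * n ≤
        (1 / ((n : ℝ) - 1)) * (∫ s in (1 : ℝ)..t, (m s) ^ 2) := by
      rw [one_div, inv_mul_eq_div, le_div_iff₀ (by linarith)]
      have : (0 : ℝ) ≤ 2 ^ (k + 1) * n := by positivity
      nlinarith
    have := hyp t (by linarith)
    linarith
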